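/- Imprecise Sklar theorem, p-box approach, part (i): Let ℱ be a nonempty set of bivariate distributions, ℱ_{X,Y} = {(F_X,F_Y) : F ∈ ℱ} the set of realized margin pairs, and for each F_{X,Y} ∈ ℱ_{X,Y} let ℱ^{F_{X,Y}} = ℱ ∩ 𝔇^{F_X,F_Y}. Assume that for every F_{X,Y} ∈ ℱ_{X,Y} the set ℱ^{F_{X,Y}} is a coherent restricted bivariate p-box. Then there exists a family {(P_{F_{X,Y}}, Q_{F_{X,Y}}) : F_{X,Y} ∈ ℱ_{X,Y}} of coherent imprecise copulas such that ℱ = { (x,y) ↦ C(F_X(x),F_Y(y)) : F_{X,Y} ∈ ℱ_{X,Y}, C ∈ 𝒞(P_{F_{X,Y}}, Q_{F_{X,Y}}) }. -/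

import Mathlib

open scoped Classical

noncomputable section

/-- The `F`-volume of the rectangle `[a₁,a₂] × [b₁,b₂]`. -/
def vol (F : EReal × EReal → ℝ) (a₁ a₂ b₁ b₂ : EReal) : ℝ :=
  F (a₂, b₂) - F (a₁, b₂) - F (a₂, b₁) + F (a₁, b₁)

/-- `x ∈ R̄` is an infinite value, i.e. `−∞` or `+∞`. -/
def IsInfinite (x : EReal) : Prop := x = ⊥ ∨ x = ⊤

/-- A bivariate quasi-distribution on `R̄²`. -/
def IsQuasiDist (F : EReal × EReal → ℝ) : Prop :=
  (∀ p : EReal × EReal, F p ∈ Set.Icc (0:ℝ) 1) ∧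
  (∀ x : EReal, F (x, ⊥) = 0) ∧ (∀ y : EReal, F (⊥, y) = 0) ∧
  F (⊤, ⊤) = 1 ∧
  (∀ a₁ a₂ b₁ b₂ : EReal, a₁ ≤ a₂ → b₁ ≤ b₂ →
    (IsInfinite a₁ ∨ IsInfinite a₂ ∨ IsInfinite b₁ ∨ IsInfinite b₂) →
    0 ≤ vol F a₁ a₂ b₁ b₂)

/-- A bivariate distribution on `R̄²` (no right-continuity assumed). -/
def IsDist (F : EReal × EReal → ℝ) : Prop :=
  (∀ p : EReal × EReal, F p ∈ Set.Icc (0:ℝ) 1) ∧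
  (∀ x : EReal, F (x, ⊥) = 0) ∧ (∀ y : EReal, F (⊥, y) = 0) ∧
  F (⊤, ⊤) = 1 ∧
  (∀ a₁ a₂ b₁ b₂ : EReal, a₁ ≤ a₂ → b₁ ≤ b₂ → 0 ≤ vol F a₁ a₂ b₁ b₂)

/-- `F` has margins `FX` and `FY`. -/
def HasMargins (F : EReal × EReal → ℝ) (FX FY : EReal → ℝ) : Prop :=
  (∀ x, F (x, ⊤) = FX x) ∧ (∀ y, F (⊤, y) = FY y)

/-- A univariate distribution function on `R̄` (no right-continuity assumed). -/
def UnivDist (F : EReal → ℝ) : Prop :=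
  Monotone F ∧ F ⊥ = 0 ∧ F ⊤ = 1

/-- A (nondegenerate) rectangle in `R̄²` with distinct standard corners. -/
structure Rect where
  x1 : EReal
  y1 : EReal
  x2 : EReal
  y2 : EReal
  hx : x1 < x2
  hy : y1 < y2

/-- The multiplicity of a point with respect to a rectangle: `+1` at the main
corners (southwest and northeast), `−1` at the opposite corners. -/
def Rect.mult (R : Rect) (p : EReal × EReal) : ℤ :=
  (if p = (R.x1, R.y1) then 1 else 0) + (if p = (R.x2, R.y2) then 1 else 0)
    - (if p = (R.x2, R.y1) then 1 else 0) - (if p = (R.x1, R.y2) then 1 else 0)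

/-- The interior of a rectangle, as a subset of `R̄²`. -/
def Rect.inter (R : Rect) : Set (EReal × EReal) :=
  Set.Ioo R.x1 R.x2 ×ˢ Set.Ioo R.y1 R.y2

/-- The image of a rectangle under the reflection `δ(x,y) = (−x,y)`. -/
def Rect.reflect (R : Rect) : Rect where
  x1 := -R.x2
  y1 := R.y1
  x2 := -R.x1
  y2 := R.y2
  hx := EReal.neg_lt_neg_iff.mpr R.hx
  hy := R.hy

/-- A finite (formal) union of rectangles is represented by a list; membership in `ℜ`
additionally requires pairwise disjointness, see `disjU`. -/
def disjU (U : List Rect) : Prop :=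
  U.Pairwise fun R S => Disjoint R.inter S.inter

/-- The multiplicity of a point with respect to a finite union of rectangles. -/
def multU (U : List Rect) (p : EReal × EReal) : ℤ :=
  (U.map fun R => R.mult p).sum

/-- The corners of a rectangle, as a list. -/
def Rect.cornerList (R : Rect) : List (EReal × EReal) :=
  [(R.x1, R.y1), (R.x2, R.y2), (R.x2, R.y1), (R.x1, R.y2)]

/-- The set of corners of a finite union of rectangles. -/
def cornersU (U : List Rect) : Finset (EReal × EReal) :=
  (U.flatMap Rect.cornerList).toFinset

/-- `L^{(A,B)}(R) = Σ_{m_R(y)>0} B(y)·m_R(y) + Σ_{m_R(y)<0} A(y)·m_R(y)`. -/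
def Lval (A B : EReal × EReal → ℝ) (U : List Rect) : ℝ :=
  ∑ p ∈ cornersU U,
    (if 0 < multU U p then B p * (multU U p : ℝ)
     else if multU U p < 0 then A p * (multU U p : ℝ) else 0)

/-- Condition (Q1): `A ≤ B` pointwise. -/
def CondQ1 (A B : EReal × EReal → ℝ) : Prop := ∀ p, A p ≤ B p

/-- Condition (Q2): `L^{(A,B)}(R) ≥ 0` for all `R ∈ ℜ`. -/
def CondQ2 (A B : EReal × EReal → ℝ) : Prop :=
  ∀ U : List Rect, disjU U → 0 ≤ Lval A B U

/-- `P_O^{(A,B)}(x) = inf { L^{(A,B)}(R)/(−m_R(x)) : R ∈ ℜ, m_R(x) < 0 }`,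
with the infimum of the empty set being `+∞`. -/
def PO (A B : EReal × EReal → ℝ) (x : EReal × EReal) : EReal :=
  ⨅ U : {U : List Rect // disjU U ∧ multU U x < 0},
    ((Lval A B U.1 / (-(multU U.1 x) : ℝ) : ℝ) : EReal)

/-- `P_M^{(A,B)}(x) = inf { L^{(A,B)}(R)/m_R(x) : R ∈ ℜ, m_R(x) > 0 }`,
with the infimum of the empty set being `+∞`. -/
def PM (A B : EReal × EReal → ℝ) (x : EReal × EReal) : EReal :=
  ⨅ U : {U : List Rect // disjU U ∧ 0 < multU U x},
    ((Lval A B U.1 / ((multU U.1 x) : ℝ) : ℝ) : EReal)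

/-- `γ^{(A,B)}(x) = min { P_O^{(A,B)}(x), B(x) − A(x) }`. -/
def gammaAB (A B : EReal × EReal → ℝ) (x : EReal × EReal) : EReal :=
  min (PO A B x) ((B x - A x : ℝ) : EReal)

/-- A quasi-copula on `[0,1]²`. -/
def IsQuasiCopula (Q : ℝ → ℝ → ℝ) : Prop :=
  (∀ u ∈ Set.Icc (0:ℝ) 1, ∀ v ∈ Set.Icc (0:ℝ) 1, Q u v ∈ Set.Icc (0:ℝ) 1) ∧
  (∀ u ∈ Set.Icc (0:ℝ) 1, Q u 0 = 0 ∧ Q 0 u = 0 ∧ Q u 1 = u ∧ Q 1 u = u) ∧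
  (∀ u ∈ Set.Icc (0:ℝ) 1, ∀ u' ∈ Set.Icc (0:ℝ) 1, ∀ v ∈ Set.Icc (0:ℝ) 1,
    u ≤ u' → Q u v ≤ Q u' v ∧ Q v u ≤ Q v u') ∧
  (∀ u ∈ Set.Icc (0:ℝ) 1, ∀ u' ∈ Set.Icc (0:ℝ) 1, ∀ v ∈ Set.Icc (0:ℝ) 1,
    ∀ v' ∈ Set.Icc (0:ℝ) 1, |Q u v - Q u' v'| ≤ |u - u'| + |v - v'|)

/-- A copula on `[0,1]²`. -/
def IsCopula (C : ℝ → ℝ → ℝ) : Prop :=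
  (∀ u ∈ Set.Icc (0:ℝ) 1, ∀ v ∈ Set.Icc (0:ℝ) 1, C u v ∈ Set.Icc (0:ℝ) 1) ∧
  (∀ u ∈ Set.Icc (0:ℝ) 1, C u 0 = 0 ∧ C 0 u = 0 ∧ C u 1 = u ∧ C 1 u = u) ∧
  (∀ u₁ ∈ Set.Icc (0:ℝ) 1, ∀ u₂ ∈ Set.Icc (0:ℝ) 1, ∀ v₁ ∈ Set.Icc (0:ℝ) 1,
    ∀ v₂ ∈ Set.Icc (0:ℝ) 1, u₁ ≤ u₂ → v₁ ≤ v₂ →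
    0 ≤ C u₂ v₂ - C u₁ v₂ - C u₂ v₁ + C u₁ v₁)

/-- `𝒞(P,Q)`: the set of copulas lying pointwise between `P` and `Q` on `[0,1]²`. -/
def Cset (P Q : ℝ → ℝ → ℝ) : Set (ℝ → ℝ → ℝ) :=
  {C | IsCopula C ∧ ∀ u ∈ Set.Icc (0:ℝ) 1, ∀ v ∈ Set.Icc (0:ℝ) 1,
    P u v ≤ C u v ∧ C u v ≤ Q u v}

/-- `(P,Q)` is a coherent imprecise copula. -/
def CoherentImprecise (P Q : ℝ → ℝ → ℝ) : Prop :=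
  IsQuasiCopula P ∧ IsQuasiCopula Q ∧
  (∀ u ∈ Set.Icc (0:ℝ) 1, ∀ v ∈ Set.Icc (0:ℝ) 1, P u v ≤ Q u v) ∧
  (Cset P Q).Nonempty ∧
  (∀ u ∈ Set.Icc (0:ℝ) 1, ∀ v ∈ Set.Icc (0:ℝ) 1,
    P u v = sInf ((fun C => C u v) '' Cset P Q) ∧
    Q u v = sSup ((fun C => C u v) '' Cset P Q))

/-- `𝔇(A,B)`: the set of bivariate distributions with margins `FX`, `FY`
lying pointwise between `A` and `B`. -/
def Dset (FX FY : EReal → ℝ) (A B : EReal × EReal → ℝ) : Set (EReal × EReal → ℝ) :=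
  {F | IsDist F ∧ HasMargins F FX FY ∧ ∀ p, A p ≤ F p ∧ F p ≤ B p}

/-- The pointwise infimum of a set of bivariate functions. -/
def pinf (S : Set (EReal × EReal → ℝ)) : EReal × EReal → ℝ :=
  fun p => sInf ((fun F => F p) '' S)

/-- The pointwise supremum of a set of bivariate functions. -/
def psup (S : Set (EReal × EReal → ℝ)) : EReal × EReal → ℝ :=
  fun p => sSup ((fun F => F p) '' S)

/-- `S` is a coherent restricted bivariate `p`-box with margins `FX`, `FY`. -/
def CoherentPBox (FX FY : EReal → ℝ) (S : Set (EReal × EReal → ℝ)) : Prop :=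
  S.Nonempty ∧ (∀ F ∈ S, IsDist F ∧ HasMargins F FX FY) ∧
  S = Dset FX FY (pinf S) (psup S) ∧
  (∀ p, pinf S p = pinf (Dset FX FY (pinf S) (psup S)) p) ∧
  (∀ p, psup S p = psup (Dset FX FY (pinf S) (psup S)) p)

/-- A mesh `Δ = δ_x × δ_y`. -/
structure Mesh where
  sx : Finset EReal
  sy : Finset EReal
  botx : ⊥ ∈ sx
  topx : ⊤ ∈ sx
  boty : ⊥ ∈ sy
  topy : ⊤ ∈ sy
  posx : ∃ a ∈ sx, 0 < a ∧ a ≠ ⊤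
  negx : ∃ a ∈ sx, a < 0 ∧ a ≠ ⊥
  posy : ∃ a ∈ sy, 0 < a ∧ a ≠ ⊤
  negy : ∃ a ∈ sy, a < 0 ∧ a ≠ ⊥

/-- A discrete bivariate quasi-distribution on the mesh `Δ`. -/
def DiscQuasiDist (Δ : Mesh) (F : EReal × EReal → ℝ) : Prop :=
  (∀ x ∈ Δ.sx, ∀ y ∈ Δ.sy, F (x, y) ∈ Set.Icc (0:ℝ) 1) ∧
  (∀ x ∈ Δ.sx, F (x, ⊥) = 0) ∧ (∀ y ∈ Δ.sy, F (⊥, y) = 0) ∧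
  F (⊤, ⊤) = 1 ∧
  (∀ a₁ ∈ Δ.sx, ∀ a₂ ∈ Δ.sx, ∀ b₁ ∈ Δ.sy, ∀ b₂ ∈ Δ.sy, a₁ ≤ a₂ → b₁ ≤ b₂ →
    (IsInfinite a₁ ∨ IsInfinite a₂ ∨ IsInfinite b₁ ∨ IsInfinite b₂) →
    0 ≤ vol F a₁ a₂ b₁ b₂)

/-- A discrete bivariate distribution on the mesh `Δ`. -/
def DiscDist (Δ : Mesh) (F : EReal × EReal → ℝ) : Prop :=
  (∀ x ∈ Δ.sx, ∀ y ∈ Δ.sy, F (x, y) ∈ Set.Icc (0:ℝ) 1) ∧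
  (∀ x ∈ Δ.sx, F (x, ⊥) = 0) ∧ (∀ y ∈ Δ.sy, F (⊥, y) = 0) ∧
  F (⊤, ⊤) = 1 ∧
  (∀ a₁ ∈ Δ.sx, ∀ a₂ ∈ Δ.sx, ∀ b₁ ∈ Δ.sy, ∀ b₂ ∈ Δ.sy, a₁ ≤ a₂ → b₁ ≤ b₂ →
    0 ≤ vol F a₁ a₂ b₁ b₂)

/-- All rectangles of the union have their corners in the mesh `Δ`. -/
def inMeshU (Δ : Mesh) (U : List Rect) : Prop :=
  ∀ R ∈ U, R.x1 ∈ Δ.sx ∧ R.x2 ∈ Δ.sx ∧ R.y1 ∈ Δ.sy ∧ R.y2 ∈ Δ.sy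

/-- The reflection `A^δ(x,y) = F_Y(y) − A(−x,y)` of `A` having second margin `FY`. -/
def reflectFun (FY : EReal → ℝ) (A : EReal × EReal → ℝ) : EReal × EReal → ℝ :=
  fun p => FY p.2 - A (-p.1, p.2)

end

section Interpolation

open Filter Topology

variable {X : Type*} {f h h₁ h₂ : X → ℝ} {u u' : ℝ}

/-- `h` is nondecreasing, with increments bounded by those of `f`. -/
def Dominated [LE X] (f h : X → ℝ) : Prop :=
  ∀ x y, x ≤ y → h x ≤ h y ∧ h y - h x ≤ f y - f x

/-- The limit of `h` along the points where `f` is at most `u`. -/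
noncomputable def lowerLim (f h : X → ℝ) (u : ℝ) : ℝ := ⨆ x : {x // f x ≤ u}, h x

/-- The limit of `h` along the points where `f` is at least `u`. -/
noncomputable def upperLim (f h : X → ℝ) (u : ℝ) : ℝ := ⨅ x : {x // u ≤ f x}, h x

/-- The position of `u` in the gap of the range of `f` that contains it. -/
noncomputable def gapRatio (f : X → ℝ) (u : ℝ) : ℝ :=
  (u - lowerLim f f u) / (upperLim f f u - lowerLim f f u)

/-- The function `φ` such that `h = φ ∘ f`, extended from the range of `f` to its closure by
continuity, and to the gaps of the closure by linear interpolation. -/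
noncomputable def interpolate (f h : X → ℝ) (u : ℝ) : ℝ :=
  lowerLim f h u + gapRatio f u * (upperLim f h u - lowerLim f h u)

lemma interpolate_zero : interpolate f (fun _ => 0) u = 0 := by
  simp [interpolate, lowerLim, upperLim]

variable [LinearOrder X]

namespace Dominated

lemma monotone (hh : Dominated f h) : Monotone h := fun x y hxy => (hh x y hxy).1

lemma self_of_monotone (hf : Monotone f) : Dominated f f := fun _ _ hxy => ⟨hf hxy, le_rfl⟩

lemma base (hh : Dominated f h) : Dominated f f :=
  self_of_monotone fun x y hxy => by linarith [(hh x y hxy).1, (hh x y hxy).2]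

lemma sub (hh₁ : Dominated f h₁) (hh₂ : Dominated f h₂) (hm : Monotone fun x => h₂ x - h₁ x) :
    Dominated f fun x => h₂ x - h₁ x := fun x y hxy =>
  ⟨hm hxy, by linarith [(hh₁ x y hxy).1, (hh₂ x y hxy).2]⟩

lemma le_of_le (hh : Dominated f h) {x y : X} (hxy : f x ≤ f y) : h x ≤ h y := by
  rcases le_total x y with hc | hc
  · exact (hh x y hc).1
  · linarith [(hh y x hc).2]

end Dominated

variable [BoundedOrder X]

lemma tendsto_lowerLim (hh : Monotone h) :
    Tendsto (fun x : {x // f x ≤ u} => h x) atTop (𝓝 (lowerLim f h u)) :=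
  tendsto_atTop_ciSup (fun _ _ hxy => hh hxy)
    ⟨h ⊤, by rintro _ ⟨x, rfl⟩; exact hh le_top⟩

lemma tendsto_upperLim (hh : Monotone h) :
    Tendsto (fun x : {x // u ≤ f x} => h x) atBot (𝓝 (upperLim f h u)) :=
  tendsto_atBot_ciInf (fun _ _ hxy => hh hxy)
    ⟨h ⊥, by rintro _ ⟨x, rfl⟩; exact hh bot_le⟩

lemma le_lowerLim (hh : Monotone h) {x : X} (hx : f x ≤ u) : h x ≤ lowerLim f h u :=
  le_ciSup (f := fun x : {x // f x ≤ u} => h x)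
    ⟨h ⊤, by rintro _ ⟨x, rfl⟩; exact hh le_top⟩ ⟨x, hx⟩

lemma upperLim_le (hh : Monotone h) {x : X} (hx : u ≤ f x) : upperLim f h u ≤ h x :=
  ciInf_le (f := fun x : {x // u ≤ f x} => h x)
    ⟨h ⊥, by rintro _ ⟨x, rfl⟩; exact hh bot_le⟩ ⟨x, hx⟩

lemma lowerLim_sub (hu : f ⊥ ≤ u) (hh₁ : Monotone h₁) (hh₂ : Monotone h₂)
    (hm : Monotone fun x => h₂ x - h₁ x) :
    lowerLim f (fun x => h₂ x - h₁ x) u = lowerLim f h₂ u - lowerLim f h₁ u :=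
  haveI : Nonempty {x // f x ≤ u} := ⟨⟨⊥, hu⟩⟩
  tendsto_nhds_unique (tendsto_lowerLim hm) ((tendsto_lowerLim hh₂).sub (tendsto_lowerLim hh₁))

lemma upperLim_sub (hu : u ≤ f ⊤) (hh₁ : Monotone h₁) (hh₂ : Monotone h₂)
    (hm : Monotone fun x => h₂ x - h₁ x) :
    upperLim f (fun x => h₂ x - h₁ x) u = upperLim f h₂ u - upperLim f h₁ u :=
  haveI : Nonempty {x // u ≤ f x} := ⟨⟨⊤, hu⟩⟩
  tendsto_nhds_unique (tendsto_upperLim hm) ((tendsto_upperLim hh₂).sub (tendsto_upperLim hh₁))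

lemma lowerLim_le_upperLim (hh : Dominated f h) (hu : u ∈ Set.Icc (f ⊥) (f ⊤)) :
    lowerLim f h u ≤ upperLim f h u :=
  haveI : Nonempty {x // f x ≤ u} := ⟨⟨⊥, hu.1⟩⟩
  haveI : Nonempty {x // u ≤ f x} := ⟨⟨⊤, hu.2⟩⟩
  ciSup_le fun x => le_ciInf fun y => hh.le_of_le (x.2.trans y.2)

lemma lowerLim_self_le (hu : f ⊥ ≤ u) : lowerLim f f u ≤ u :=
  haveI : Nonempty {x // f x ≤ u} := ⟨⟨⊥, hu⟩⟩
  ciSup_le fun x => x.2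

lemma le_upperLim_self (hu : u ≤ f ⊤) : u ≤ upperLim f f u :=
  haveI : Nonempty {x // u ≤ f x} := ⟨⟨⊤, hu⟩⟩
  le_ciInf fun x => x.2

lemma gapRatio_mem_Icc (hu : u ∈ Set.Icc (f ⊥) (f ⊤)) : gapRatio f u ∈ Set.Icc (0 : ℝ) 1 := by
  have h₁ := lowerLim_self_le hu.1
  have h₂ := le_upperLim_self hu.2
  exact ⟨div_nonneg (by linarith) (by linarith), div_le_one_of_le₀ (by linarith) (by linarith)⟩

lemma lowerLim_le_interpolate (hh : Dominated f h) (hu : u ∈ Set.Icc (f ⊥) (f ⊤)) :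
    lowerLim f h u ≤ interpolate f h u :=
  le_add_of_nonneg_right <|
    mul_nonneg (gapRatio_mem_Icc hu).1 (sub_nonneg.2 (lowerLim_le_upperLim hh hu))

lemma interpolate_le_upperLim (hh : Dominated f h) (hu : u ∈ Set.Icc (f ⊥) (f ⊤)) :
    interpolate f h u ≤ upperLim f h u := by
  have := mul_le_mul_of_nonneg_right (gapRatio_mem_Icc hu).2
    (sub_nonneg.2 (lowerLim_le_upperLim hh hu))
  unfold interpolate
  linarith

lemma interpolate_apply (hh : Dominated f h) (x : X) : interpolate f h (f x) = h x := by
  have hu : f x ∈ Set.Icc (f ⊥) (f ⊤) := ⟨hh.base.monotone bot_le, hh.base.monotone le_top⟩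
  exact le_antisymm ((interpolate_le_upperLim hh hu).trans (upperLim_le hh.monotone le_rfl))
    ((le_lowerLim hh.monotone le_rfl).trans (lowerLim_le_interpolate hh hu))

lemma interpolate_self (hu : u ∈ Set.Icc (f ⊥) (f ⊤)) : interpolate f f u = u := by
  have h₁ := lowerLim_self_le hu.1
  have h₂ := le_upperLim_self hu.2
  unfold interpolate gapRatio
  rcases eq_or_ne (upperLim f f u - lowerLim f f u) 0 with h₀ | h₀
  · rw [h₀]
    linarith
  · rw [div_mul_cancel₀ _ h₀]
    ring

lemma interpolate_sub (hu : u ∈ Set.Icc (f ⊥) (f ⊤)) (hh₁ : Monotone h₁) (hh₂ : Monotone h₂)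
    (hm : Monotone fun x => h₂ x - h₁ x) :
    interpolate f (fun x => h₂ x - h₁ x) u = interpolate f h₂ u - interpolate f h₁ u := by
  unfold interpolate
  rw [lowerLim_sub hu.1 hh₁ hh₂ hm, upperLim_sub hu.2 hh₁ hh₂ hm]
  ring

lemma interpolate_mono (hh : Dominated f h) (hu : u ∈ Set.Icc (f ⊥) (f ⊤))
    (hu' : u' ∈ Set.Icc (f ⊥) (f ⊤)) (huu' : u ≤ u') :
    interpolate f h u ≤ interpolate f h u' := by
  by_cases hx : ∃ x, u ≤ f x ∧ f x ≤ u'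
  · obtain ⟨x, hux, hxu'⟩ := hx
    exact (interpolate_le_upperLim hh hu).trans <| (upperLim_le hh.monotone hux).trans <|
      (le_lowerLim hh.monotone hxu').trans (lowerLim_le_interpolate hh hu')
  · push Not at hx
    have hlow : (fun x => f x ≤ u') = fun x => f x ≤ u := by
      ext x
      refine ⟨fun h' => ?_, fun h' => h'.trans huu'⟩
      by_contra! hc
      exact (hx x hc.le).not_ge h'
    have hupp : (fun x => u' ≤ f x) = fun x => u ≤ f x := by
      ext x
      exact ⟨huu'.trans, fun h' => (hx x h').le⟩
    have hl (k : X → ℝ) : lowerLim f k u' = lowerLim f k u := by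
      unfold lowerLim; rw [hlow]
    have hr (k : X → ℝ) : upperLim f k u' = upperLim f k u := by
      unfold upperLim; rw [hupp]
    have hgap := sub_nonneg.2 (lowerLim_le_upperLim hh hu)
    have hgapf := sub_nonneg.2 (lowerLim_le_upperLim hh.base hu)
    unfold interpolate gapRatio
    rw [hl, hl, hr, hr]
    gcongr

end Interpolation

section Sklar

variable {F : EReal × EReal → ℝ}

lemma IsDist.dominated_left (hF : IsDist F) (y : EReal) :
    Dominated (fun x => F (x, ⊤)) (fun x => F (x, y)) := by
  obtain ⟨-, hb, -, -, hv⟩ := hF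
  intro x x' hx
  have h₁ := hv x x' ⊥ y hx bot_le
  have h₂ := hv x x' y ⊤ hx le_top
  simp only [vol, hb] at h₁ h₂
  constructor <;> linarith

lemma IsDist.dominated_left_sub (hF : IsDist F) {y y' : EReal} (hy : y ≤ y') :
    Dominated (fun x => F (x, ⊤)) (fun x => F (x, y') - F (x, y)) := by
  refine (hF.dominated_left y).sub (hF.dominated_left y') fun x x' hx => ?_
  have := hF.2.2.2.2 x x' y y' hx hy
  simp only [vol] at this
  linarith

/-- The function `F`, with its first variable rescaled by the first margin. -/
noncomputable def halfCopula (F : EReal × EReal → ℝ) (u : ℝ) (y : EReal) : ℝ :=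
  interpolate (fun x => F (x, ⊤)) (fun x => F (x, y)) u

lemma IsDist.margin_left_bot (hF : IsDist F) : F (⊥, ⊤) = 0 := hF.2.2.1 ⊤

lemma IsDist.margin_right_bot (hF : IsDist F) : F (⊤, ⊥) = 0 := hF.2.1 ⊤

lemma IsDist.top_top (hF : IsDist F) : F (⊤, ⊤) = 1 := hF.2.2.2.1

lemma halfCopula_apply (hF : IsDist F) (x y : EReal) : halfCopula F (F (x, ⊤)) y = F (x, y) :=
  interpolate_apply (hF.dominated_left y) x

lemma halfCopula_zero (hF : IsDist F) (y : EReal) : halfCopula F 0 y = 0 := by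
  rw [← hF.margin_left_bot, halfCopula_apply hF, hF.2.2.1, hF.2.2.1]

lemma halfCopula_one (hF : IsDist F) (y : EReal) : halfCopula F 1 y = F (⊤, y) := by
  rw [← hF.top_top, halfCopula_apply hF]

lemma halfCopula_increment_mono (hF : IsDist F) {u u' : ℝ} (hu : u ∈ Set.Icc (0 : ℝ) 1)
    (hu' : u' ∈ Set.Icc (0 : ℝ) 1) (huu' : u ≤ u') {y y' : EReal} (hy : y ≤ y') :
    halfCopula F u y' - halfCopula F u y ≤ halfCopula F u' y' - halfCopula F u' y := by
  rw [← hF.margin_left_bot, ← hF.top_top] at hu hu'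
  have hd := hF.dominated_left_sub hy
  have hm := interpolate_mono hd hu hu' huu'
  rwa [interpolate_sub hu (hF.dominated_left y).monotone (hF.dominated_left y').monotone
      hd.monotone,
    interpolate_sub hu' (hF.dominated_left y).monotone (hF.dominated_left y').monotone
      hd.monotone] at hm

lemma dominated_halfCopula (hF : IsDist F) {u : ℝ} (hu : u ∈ Set.Icc (0 : ℝ) 1) :
    Dominated (fun y => F (⊤, y)) (halfCopula F u) := by
  intro y y' hy
  have h₀ := halfCopula_increment_mono hF ⟨le_rfl, zero_le_one⟩ hu hu.1 hy
  have h₁ := halfCopula_increment_mono hF hu ⟨zero_le_one, le_rfl⟩ hu.2 hy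
  simp only [halfCopula_zero hF, halfCopula_one hF] at h₀ h₁
  exact ⟨by linarith, h₁⟩

/-- Sklar's theorem: a bivariate distribution factors through a copula. -/
theorem IsDist.exists_copula (hF : IsDist F) :
    ∃ C, IsCopula C ∧ ∀ p : EReal × EReal, C (F (p.1, ⊤)) (F (⊤, p.2)) = F p := by
  set g : EReal → ℝ := fun y => F (⊤, y) with hg
  set C : ℝ → ℝ → ℝ := fun u v => interpolate g (halfCopula F u) v with hC
  have hI {v : ℝ} (hv : v ∈ Set.Icc (0 : ℝ) 1) : v ∈ Set.Icc (g ⊥) (g ⊤) := by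
    simpa only [hg, hF.margin_right_bot, hF.top_top] using hv
  have hC₀ (u : ℝ) (hu : u ∈ Set.Icc (0 : ℝ) 1) : C u 0 = 0 ∧ C 0 u = 0 ∧ C u 1 = u ∧ C 1 u = u := by
    have hd := dominated_halfCopula hF hu
    refine ⟨?_, ?_, ?_, ?_⟩
    · have := interpolate_apply hd ⊥
      rw [hF.margin_right_bot] at this
      simp only [hC, hg, this, halfCopula, hF.2.1]
      exact interpolate_zero
    · have : halfCopula F 0 = fun _ => 0 := funext (halfCopula_zero hF)
      simp only [hC, this]
      exact interpolate_zero
    · have := interpolate_apply hd ⊤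
      rw [hF.top_top] at this
      simp only [hC, hg, this, halfCopula]
      exact interpolate_self (by simpa only [hF.margin_left_bot, hF.top_top] using hu)
    · have : halfCopula F 1 = g := funext (halfCopula_one hF)
      simp only [hC, this]
      exact interpolate_self (hI hu)
  have hvol : ∀ u₁ ∈ Set.Icc (0:ℝ) 1, ∀ u₂ ∈ Set.Icc (0:ℝ) 1, ∀ v₁ ∈ Set.Icc (0:ℝ) 1,
      ∀ v₂ ∈ Set.Icc (0:ℝ) 1, u₁ ≤ u₂ → v₁ ≤ v₂ →
      0 ≤ C u₂ v₂ - C u₁ v₂ - C u₂ v₁ + C u₁ v₁ := by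
    intro u₁ hu₁ u₂ hu₂ v₁ hv₁ v₂ hv₂ hu hv
    have hd₁ := dominated_halfCopula hF hu₁
    have hd₂ := dominated_halfCopula hF hu₂
    have hd := hd₁.sub hd₂ fun y y' hy => by
      linarith [halfCopula_increment_mono hF hu₁ hu₂ hu hy]
    have hm := interpolate_mono hd (hI hv₁) (hI hv₂) hv
    rw [interpolate_sub (hI hv₁) hd₁.monotone hd₂.monotone hd.monotone,
      interpolate_sub (hI hv₂) hd₁.monotone hd₂.monotone hd.monotone] at hm
    simp only [hC]
    linarith
  have h0 : (0 : ℝ) ∈ Set.Icc (0 : ℝ) 1 := ⟨le_rfl, zero_le_one⟩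
  have h1 : (1 : ℝ) ∈ Set.Icc (0 : ℝ) 1 := ⟨zero_le_one, le_rfl⟩
  refine ⟨C, ⟨fun u hu v hv => ⟨?_, ?_⟩, hC₀, hvol⟩, fun p => ?_⟩
  · linarith [hvol 0 h0 u hu 0 h0 v hv hu.1 hv.1, (hC₀ u hu).1, (hC₀ v hv).2.1, (hC₀ 0 h0).1]
  · linarith [hvol 0 h0 u hu v hv 1 h1 hu.1 hv.2, (hC₀ u hu).2.2.1, (hC₀ v hv).2.1,
      (hC₀ 1 h1).2.1, hu.2]
  · have hd := dominated_halfCopula hF (hF.1 (p.1, ⊤))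
    exact (interpolate_apply hd p.2).trans (halfCopula_apply hF p.1 p.2)

end Sklar

section Copulas

variable {C : ℝ → ℝ → ℝ} {T : Set (ℝ → ℝ → ℝ)}

lemma IsCopula.isQuasiCopula (hC : IsCopula C) : IsQuasiCopula C := by
  obtain ⟨hr, hb, hv⟩ := hC
  have h0 : (0 : ℝ) ∈ Set.Icc (0 : ℝ) 1 := ⟨le_rfl, zero_le_one⟩
  have h1 : (1 : ℝ) ∈ Set.Icc (0 : ℝ) 1 := ⟨zero_le_one, le_rfl⟩
  have hmono : ∀ u ∈ Set.Icc (0:ℝ) 1, ∀ u' ∈ Set.Icc (0:ℝ) 1, ∀ v ∈ Set.Icc (0:ℝ) 1,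
      u ≤ u' → C u v ≤ C u' v ∧ C v u ≤ C v u' := fun u hu u' hu' v hv' huu' => by
    constructor
    · linarith [hv u hu u' hu' 0 h0 v hv' huu' hv'.1, (hb u hu).1, (hb u' hu').1]
    · linarith [hv 0 h0 v hv' u hu u' hu' hv'.1 huu', (hb u hu).2.1, (hb u' hu').2.1]
  have hlip : ∀ u ∈ Set.Icc (0:ℝ) 1, ∀ u' ∈ Set.Icc (0:ℝ) 1, ∀ v ∈ Set.Icc (0:ℝ) 1,
      |C u v - C u' v| ≤ |u - u'| ∧ |C v u - C v u'| ≤ |u - u'| := by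
    intro u hu u' hu' v hv'
    wlog huu' : u ≤ u' generalizing u u'
    · rw [abs_sub_comm (C u v), abs_sub_comm (C v u), abs_sub_comm u]
      exact this u' hu' u hu (le_of_not_ge huu')
    obtain ⟨hm₁, hm₂⟩ := hmono u hu u' hu' v hv' huu'
    rw [abs_sub_comm (C u v), abs_sub_comm (C v u), abs_sub_comm u, abs_of_nonneg (by linarith),
      abs_of_nonneg (by linarith), abs_of_nonneg (by linarith)]
    constructor
    · linarith [hv u hu u' hu' v hv' 1 h1 huu' hv'.2, (hb u hu).2.2.1, (hb u' hu').2.2.1]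
    · linarith [hv v hv' 1 h1 u hu u' hu' hv'.2 huu', (hb u hu).2.2.2, (hb u' hu').2.2.2]
  exact ⟨hr, hb, hmono, fun u hu u' hu' v hv v' hv' => (abs_sub_le _ (C u' v) _).trans
    (add_le_add (hlip u hu u' hu' v hv).1 (hlip v hv v' hv' u' hu').2)⟩

lemma bddBelow_eval (hT : ∀ C ∈ T, IsQuasiCopula C) {u v : ℝ} (hu : u ∈ Set.Icc (0 : ℝ) 1)
    (hv : v ∈ Set.Icc (0 : ℝ) 1) : BddBelow ((fun C : ℝ → ℝ → ℝ => C u v) '' T) :=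
  ⟨0, by rintro _ ⟨C, hC, rfl⟩; exact ((hT C hC).1 u hu v hv).1⟩

lemma bddAbove_eval (hT : ∀ C ∈ T, IsQuasiCopula C) {u v : ℝ} (hu : u ∈ Set.Icc (0 : ℝ) 1)
    (hv : v ∈ Set.Icc (0 : ℝ) 1) : BddAbove ((fun C : ℝ → ℝ → ℝ => C u v) '' T) :=
  ⟨1, by rintro _ ⟨C, hC, rfl⟩; exact ((hT C hC).1 u hu v hv).2⟩

lemma eval_image_eq_singleton (hne : T.Nonempty) {u v c : ℝ} (hc : ∀ C ∈ T, C u v = c) :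
    (fun C : ℝ → ℝ → ℝ => C u v) '' T = {c} := by
  rw [Set.image_congr hc, hne.image_const]

lemma isQuasiCopula_sInf (hne : T.Nonempty) (hT : ∀ C ∈ T, IsQuasiCopula C) :
    IsQuasiCopula fun u v => sInf ((fun C => C u v) '' T) := by
  have hle {u v : ℝ} (hu : u ∈ Set.Icc (0 : ℝ) 1) (hv : v ∈ Set.Icc (0 : ℝ) 1)
      (C) (hC : C ∈ T) : sInf ((fun C => C u v) '' T) ≤ C u v :=
    csInf_le (bddBelow_eval hT hu hv) ⟨C, hC, rfl⟩
  have hge {u v a : ℝ} (ha : ∀ C ∈ T, a ≤ C u v) : a ≤ sInf ((fun C => C u v) '' T) :=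
    le_csInf (hne.image _) (by rintro _ ⟨C, hC, rfl⟩; exact ha C hC)
  obtain ⟨C₀, hC₀⟩ := hne
  refine ⟨fun u hu v hv => ⟨hge fun C hC => ((hT C hC).1 u hu v hv).1,
    (hle hu hv C₀ hC₀).trans ((hT C₀ hC₀).1 u hu v hv).2⟩, fun u hu => ?_,
    fun u hu u' hu' v hv huu' => ⟨?_, ?_⟩, fun u hu u' hu' v hv v' hv' => ?_⟩
  · refine ⟨?_, ?_, ?_, ?_⟩ <;> beta_reduce <;>
      rw [eval_image_eq_singleton ⟨C₀, hC₀⟩, csInf_singleton] <;> intro C hC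
    exacts [((hT C hC).2.1 u hu).1, ((hT C hC).2.1 u hu).2.1, ((hT C hC).2.1 u hu).2.2.1,
      ((hT C hC).2.1 u hu).2.2.2]
  · exact hge fun C hC => (hle hu hv C hC).trans ((hT C hC).2.2.1 u hu u' hu' v hv huu').1
  · exact hge fun C hC => (hle hv hu C hC).trans ((hT C hC).2.2.1 u hu u' hu' v hv huu').2
  · rw [abs_sub_le_iff, sub_le_comm, sub_le_comm (b := sInf _) (c := _ + _)]
    constructor <;> refine hge fun C hC => ?_
    · linarith [hle hu hv C hC, (abs_sub_le_iff.1 ((hT C hC).2.2.2 u hu u' hu' v hv v' hv')).1]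
    · linarith [hle hu' hv' C hC, (abs_sub_le_iff.1 ((hT C hC).2.2.2 u hu u' hu' v hv v' hv')).2]

lemma isQuasiCopula_sSup (hne : T.Nonempty) (hT : ∀ C ∈ T, IsQuasiCopula C) :
    IsQuasiCopula fun u v => sSup ((fun C => C u v) '' T) := by
  have hge {u v : ℝ} (hu : u ∈ Set.Icc (0 : ℝ) 1) (hv : v ∈ Set.Icc (0 : ℝ) 1)
      (C) (hC : C ∈ T) : C u v ≤ sSup ((fun C => C u v) '' T) :=
    le_csSup (bddAbove_eval hT hu hv) ⟨C, hC, rfl⟩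
  have hle {u v a : ℝ} (ha : ∀ C ∈ T, C u v ≤ a) : sSup ((fun C => C u v) '' T) ≤ a :=
    csSup_le (hne.image _) (by rintro _ ⟨C, hC, rfl⟩; exact ha C hC)
  obtain ⟨C₀, hC₀⟩ := hne
  refine ⟨fun u hu v hv => ⟨((hT C₀ hC₀).1 u hu v hv).1.trans (hge hu hv C₀ hC₀),
    hle fun C hC => ((hT C hC).1 u hu v hv).2⟩, fun u hu => ?_,
    fun u hu u' hu' v hv huu' => ⟨?_, ?_⟩, fun u hu u' hu' v hv v' hv' => ?_⟩
  · refine ⟨?_, ?_, ?_, ?_⟩ <;> beta_reduce <;>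
      rw [eval_image_eq_singleton ⟨C₀, hC₀⟩, csSup_singleton] <;> intro C hC
    exacts [((hT C hC).2.1 u hu).1, ((hT C hC).2.1 u hu).2.1, ((hT C hC).2.1 u hu).2.2.1,
      ((hT C hC).2.1 u hu).2.2.2]
  · exact hle fun C hC => ((hT C hC).2.2.1 u hu u' hu' v hv huu').1.trans (hge hu' hv C hC)
  · exact hle fun C hC => ((hT C hC).2.2.1 u hu u' hu' v hv huu').2.trans (hge hv hu' C hC)
  · rw [abs_sub_le_iff, sub_le_iff_le_add, sub_le_iff_le_add]
    constructor <;> refine hle fun C hC => ?_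
    · linarith [hge hu' hv' C hC, (abs_sub_le_iff.1 ((hT C hC).2.2.2 u hu u' hu' v hv v' hv')).1]
    · linarith [hge hu hv C hC, (abs_sub_le_iff.1 ((hT C hC).2.2.2 u hu u' hu' v hv v' hv')).2]

lemma coherentImprecise_of_Cset_eq (hne : T.Nonempty) (hT : ∀ C ∈ T, IsCopula C)
    (heq : Cset (fun u v => sInf ((fun C => C u v) '' T))
      (fun u v => sSup ((fun C => C u v) '' T)) = T) :
    CoherentImprecise (fun u v => sInf ((fun C => C u v) '' T))
      (fun u v => sSup ((fun C => C u v) '' T)) := by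
  have hT' : ∀ C ∈ T, IsQuasiCopula C := fun C hC => (hT C hC).isQuasiCopula
  refine ⟨isQuasiCopula_sInf hne hT', isQuasiCopula_sSup hne hT', fun u hu v hv => ?_, ?_, ?_⟩
  · exact csInf_le_csSup (hne.image _) (bddBelow_eval hT' hu hv) (bddAbove_eval hT' hu hv)
  · rwa [heq]
  · rw [heq]
    exact fun u _ v _ => ⟨rfl, rfl⟩

lemma IsCopula.isDist_comp (hC : IsCopula C) {f g : EReal → ℝ} (hf : UnivDist f)
    (hg : UnivDist g) : IsDist fun p => C (f p.1) (g p.2) := by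
  have hI {k : EReal → ℝ} (hk : UnivDist k) (x : EReal) : k x ∈ Set.Icc (0 : ℝ) 1 :=
    ⟨hk.2.1 ▸ hk.1 bot_le, hk.2.2 ▸ hk.1 le_top⟩
  obtain ⟨hr, hb, hv⟩ := hC
  refine ⟨fun p => hr _ (hI hf _) _ (hI hg _), fun x => ?_, fun y => ?_, ?_,
    fun a₁ a₂ b₁ b₂ ha hb => hv _ (hI hf _) _ (hI hf _) _ (hI hg _) _ (hI hg _)
      (hf.1 ha) (hg.1 hb)⟩
  · exact hg.2.1 ▸ (hb _ (hI hf x)).1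
  · exact hf.2.1 ▸ (hb _ (hI hg y)).2.1
  · simp only [hf.2.2, hg.2.2]
    exact (hb 1 ⟨zero_le_one, le_rfl⟩).2.2.1

lemma IsCopula.hasMargins_comp (hC : IsCopula C) {f g : EReal → ℝ} (hf : UnivDist f)
    (hg : UnivDist g) : HasMargins (fun p => C (f p.1) (g p.2)) f g := by
  refine ⟨fun x => ?_, fun y => ?_⟩
  · have hx : f x ∈ Set.Icc (0 : ℝ) 1 := ⟨hf.2.1 ▸ hf.1 bot_le, hf.2.2 ▸ hf.1 le_top⟩
    simpa only [hg.2.2] using (hC.2.1 _ hx).2.2.1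
  · have hy : g y ∈ Set.Icc (0 : ℝ) 1 := ⟨hg.2.1 ▸ hg.1 bot_le, hg.2.2 ▸ hg.1 le_top⟩
    simpa only [hf.2.2] using (hC.2.1 _ hy).2.2.2

lemma IsDist.univDist_left {F : EReal × EReal → ℝ} (hF : IsDist F) :
    UnivDist fun x => F (x, ⊤) :=
  ⟨(hF.dominated_left ⊤).monotone, hF.margin_left_bot, hF.top_top⟩

lemma IsDist.univDist_right {F : EReal × EReal → ℝ} (hF : IsDist F) :
    UnivDist fun y => F (⊤, y) :=
  ⟨(dominated_halfCopula hF ⟨le_rfl, zero_le_one⟩).base.monotone, hF.margin_right_bot, hF.top_top⟩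

/-- The copulas that combine the margins `f` and `g` to a member of `S`. -/
def copulasOf (f g : EReal → ℝ) (S : Set (EReal × EReal → ℝ)) : Set (ℝ → ℝ → ℝ) :=
  {C | IsCopula C ∧ (fun p => C (f p.1) (g p.2)) ∈ S}

lemma CoherentPBox.image_copulasOf {f g : EReal → ℝ} {S : Set (EReal × EReal → ℝ)}
    (hS : CoherentPBox f g S) :
    (fun (C : ℝ → ℝ → ℝ) (p : EReal × EReal) => C (f p.1) (g p.2)) '' copulasOf f g S = S := by
  refine Set.Subset.antisymm (by rintro _ ⟨C, hC, rfl⟩; exact hC.2) fun F hF => ?_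
  obtain ⟨hd, hm⟩ := hS.2.1 F hF
  obtain ⟨C, hC, hCF⟩ := hd.exists_copula
  have heq : (fun p : EReal × EReal => C (f p.1) (g p.2)) = F := by
    funext p
    rw [← hCF p, hm.1, hm.2]
  exact ⟨C, ⟨hC, heq ▸ hF⟩, heq⟩

lemma CoherentPBox.Cset_copulasOf {f g : EReal → ℝ} {S : Set (EReal × EReal → ℝ)}
    (hS : CoherentPBox f g S) (hf : UnivDist f) (hg : UnivDist g) :
    Cset (fun u v => sInf ((fun C => C u v) '' copulasOf f g S))
      (fun u v => sSup ((fun C => C u v) '' copulasOf f g S)) = copulasOf f g S := by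
  have hT : ∀ C ∈ copulasOf f g S, IsQuasiCopula C := fun C hC => hC.1.isQuasiCopula
  refine Set.Subset.antisymm (fun C hC => ⟨hC.1, ?_⟩) fun C hC => ⟨hC.1, fun u hu v hv =>
    ⟨csInf_le (bddBelow_eval hT hu hv) ⟨C, hC, rfl⟩,
      le_csSup (bddAbove_eval hT hu hv) ⟨C, hC, rfl⟩⟩⟩
  have hI {k : EReal → ℝ} (hk : UnivDist k) (x : EReal) : k x ∈ Set.Icc (0 : ℝ) 1 :=
    ⟨hk.2.1 ▸ hk.1 bot_le, hk.2.2 ▸ hk.1 le_top⟩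
  have himage (p : EReal × EReal) : (fun F : EReal × EReal → ℝ => F p) '' S =
      (fun C : ℝ → ℝ → ℝ => C (f p.1) (g p.2)) '' copulasOf f g S := by
    conv_lhs => rw [← hS.image_copulasOf, Set.image_image]
  rw [hS.2.2.1]
  refine ⟨hC.1.isDist_comp hf hg, hC.1.hasMargins_comp hf hg, fun p => ?_⟩
  simp only [pinf, psup, himage]
  exact hC.2 _ (hI hf p.1) _ (hI hg p.2)

end Copulas

/-- **Imprecise Sklar theorem, p-box approach, part (i).** If every fixed-margins slice of
`ℱ` is a coherent restricted bivariate `p`-box, then `ℱ` is the union over its margin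
pairs of the copula-images of a family of coherent imprecise copulas. -/
theorem pbox_imprecise_sklar_i
    (Fam : Set (EReal × EReal → ℝ)) (hne : Fam.Nonempty)
    (hdist : ∀ F ∈ Fam, IsDist F)
    (hpbox : ∀ F0 ∈ Fam,
      CoherentPBox (fun x => F0 (x, ⊤)) (fun y => F0 (⊤, y))
        {F ∈ Fam | HasMargins F (fun x => F0 (x, ⊤)) (fun y => F0 (⊤, y))}) :
    ∃ P Q : (EReal → ℝ) → (EReal → ℝ) → ℝ → ℝ → ℝ,
      (∀ F0 ∈ Fam,
        CoherentImprecise (P (fun x => F0 (x, ⊤)) (fun y => F0 (⊤, y)))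
          (Q (fun x => F0 (x, ⊤)) (fun y => F0 (⊤, y)))) ∧
      Fam = {G : EReal × EReal → ℝ | ∃ F0 ∈ Fam,
        ∃ C ∈ Cset (P (fun x => F0 (x, ⊤)) (fun y => F0 (⊤, y)))
            (Q (fun x => F0 (x, ⊤)) (fun y => F0 (⊤, y))),
          G = fun p => C (F0 (p.1, ⊤)) (F0 (⊤, p.2))} := by
  have hmargin (F0) (h0 : F0 ∈ Fam) :
      copulasOf (fun x => F0 (x, ⊤)) (fun y => F0 (⊤, y)) Fam =
        copulasOf (fun x => F0 (x, ⊤)) (fun y => F0 (⊤, y))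
          {F ∈ Fam | HasMargins F (fun x => F0 (x, ⊤)) (fun y => F0 (⊤, y))} :=
    Set.ext fun C => ⟨fun hC => ⟨hC.1, hC.2, hC.1.hasMargins_comp (hdist F0 h0).univDist_left
      (hdist F0 h0).univDist_right⟩, fun hC => ⟨hC.1, hC.2.1⟩⟩
  have hCset (F0) (h0 : F0 ∈ Fam) :
      Cset (fun u v => sInf ((fun C => C u v) ''
          copulasOf (fun x => F0 (x, ⊤)) (fun y => F0 (⊤, y)) Fam))
        (fun u v => sSup ((fun C => C u v) ''
          copulasOf (fun x => F0 (x, ⊤)) (fun y => F0 (⊤, y)) Fam)) =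
        copulasOf (fun x => F0 (x, ⊤)) (fun y => F0 (⊤, y)) Fam := by
    rw [hmargin F0 h0]
    exact (hpbox F0 h0).Cset_copulasOf (hdist F0 h0).univDist_left (hdist F0 h0).univDist_right
  have hmem (F0) (h0 : F0 ∈ Fam) :
      ∃ C ∈ copulasOf (fun x => F0 (x, ⊤)) (fun y => F0 (⊤, y)) Fam,
        F0 = fun p => C (F0 (p.1, ⊤)) (F0 (⊤, p.2)) := by
    obtain ⟨C, hC, hCF⟩ := (hdist F0 h0).exists_copula
    exact ⟨C, ⟨hC, by rwa [funext hCF]⟩, (funext hCF).symm⟩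
  refine ⟨fun f g u v => sInf ((fun C => C u v) '' copulasOf f g Fam),
    fun f g u v => sSup ((fun C => C u v) '' copulasOf f g Fam), fun F0 h0 => ?_, ?_⟩
  · obtain ⟨C, hC, -⟩ := hmem F0 h0
    exact coherentImprecise_of_Cset_eq ⟨C, hC⟩ (fun C hC => hC.1) (hCset F0 h0)
  · ext G
    constructor
    · intro hG
      obtain ⟨C, hC, hGC⟩ := hmem G hG
      exact ⟨G, hG, C, (hCset G hG).symm ▸ hC, hGC⟩
    · rintro ⟨F0, h0, C, hC, rfl⟩
      rw [hCset F0 h0] at hC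
      exact hC.2
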